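/- Let f(q) = q + ∑_{k=2}^∞ qᵏ pₖ be a slice regular function on the open unit ball 𝔹 of the quaternions such that the function g(q) := q f′(q) = q + ∑_{k=2}^∞ qᵏ k pₖ belongs to the class S* of slice starlike functions. Then |q| + ∑_{k=2}^∞ |q|ᵏ |pₖ| ≤ 1 for every q ∈ 𝔹 with |q| ≤ 1/2, and the constant 1/2 cannot be improved. -/

import Mathlib

noncomputable section
open scoped Quaternion

/-- Value of the slice regular function with Taylor coefficients `p` at `q`. -/
noncomputable def sliceVal (p : ℕ → ℍ[ℝ]) (q : ℍ[ℝ]) : ℍ[ℝ] := ∑' k : ℕ, q ^ k * p k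

/-- Slice derivative: `f'(q) = ∑_{k≥1} q^{k-1} k p_k`. -/
noncomputable def sliceDeriv (p : ℕ → ℍ[ℝ]) (q : ℍ[ℝ]) : ℍ[ℝ] :=
  ∑' k : ℕ, q ^ k * (((k : ℝ) + 1) • p (k + 1))

/-- The power series with coefficients `p` converges on the open unit ball. -/
def SliceRegOn (p : ℕ → ℍ[ℝ]) : Prop :=
  ∀ q : ℍ[ℝ], ‖q‖ < 1 → Summable fun k : ℕ => q ^ k * p k

/-- The class `S*` of slice starlike functions `f(q) = q + ∑_{k≥2} q^k p_k`. -/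
def SliceStarlike (p : ℕ → ℍ[ℝ]) : Prop :=
  SliceRegOn p ∧ p 0 = 0 ∧ p 1 = 1 ∧
    (∀ q : ℍ[ℝ], ‖q‖ < 1 → q ≠ 0 → sliceVal p q ≠ 0) ∧
    (∀ q : ℍ[ℝ], ‖q‖ < 1 → q ≠ 0 → 0 < ((sliceVal p q)⁻¹ * q * sliceDeriv p q).re)

section BohrAux
open PowerSeries

def AS (U : PowerSeries ℍ[ℝ]) : Prop :=
  ∀ r : ℝ, 0 ≤ r → r < 1 → Summable fun n => r ^ n * ‖coeff n U‖

def ev (U : PowerSeries ℍ[ℝ]) (z : ℍ[ℝ]) : ℍ[ℝ] := ∑' n, z ^ n * coeff n U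

lemma AS.summable {U : PowerSeries ℍ[ℝ]} (hU : AS U) {z : ℍ[ℝ]} (hz : ‖z‖ < 1) :
    Summable fun n => z ^ n * coeff n U := by
  apply Summable.of_norm
  simpa [norm_mul, norm_pow] using hU ‖z‖ (norm_nonneg _) hz

lemma AS.summable_prod {U V : PowerSeries ℍ[ℝ]} (hU : AS U) (hV : AS V) {r : ℝ} (h0 : 0 ≤ r)
    (h1 : r < 1) : Summable fun x : ℕ × ℕ => (r ^ x.1 * ‖coeff x.1 U‖) * (r ^ x.2 * ‖coeff x.2 V‖) :=
  Summable.mul_of_nonneg (hU r h0 h1) (hV r h0 h1)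
    (fun _ => mul_nonneg (pow_nonneg h0 _) (norm_nonneg _))
    (fun _ => mul_nonneg (pow_nonneg h0 _) (norm_nonneg _))

lemma AS.mul {U V : PowerSeries ℍ[ℝ]} (hU : AS U) (hV : AS V) : AS (U * V) := by
  intro r h0 h1
  have h := summable_sum_mul_antidiagonal_of_summable_mul
    (f := fun n => r ^ n * ‖coeff n U‖) (g := fun n => r ^ n * ‖coeff n V‖)
    (hU.summable_prod hV h0 h1)
  refine Summable.of_nonneg_of_le
    (fun _ => mul_nonneg (pow_nonneg h0 _) (norm_nonneg _)) (fun n => ?_) h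
  rw [coeff_mul]
  calc r ^ n * ‖∑ p ∈ Finset.HasAntidiagonal.antidiagonal n, coeff p.1 U * coeff p.2 V‖
      ≤ r ^ n * ∑ p ∈ Finset.HasAntidiagonal.antidiagonal n, ‖coeff p.1 U * coeff p.2 V‖ := by
        gcongr; exact norm_sum_le _ _
    _ = _ := by
        rw [Finset.mul_sum]
        refine Finset.sum_congr rfl fun p hp => ?_
        rw [← Finset.HasAntidiagonal.mem_antidiagonal.mp hp, pow_add, norm_mul]; ring

lemma ev_mul {U V : PowerSeries ℍ[ℝ]} (hU : AS U) (hV : AS V) {z : ℍ[ℝ]} (hz : ‖z‖ < 1) :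
    ev (U * V) z = ∑' j, z ^ j * ev U z * coeff j V := by
  set F : ℕ × ℕ → ℍ[ℝ] := fun x => z ^ (x.1 + x.2) * coeff x.1 U * coeff x.2 V with hF
  have hs : Summable F := by
    apply Summable.of_norm
    refine (hU.summable_prod hV (norm_nonneg z) hz).congr fun x => ?_
    simp only [hF, norm_mul, norm_pow, pow_add]; ring
  have h1 : ∑' x, F x = ev (U * V) z := by
    rw [← Finset.HasAntidiagonal.sigmaAntidiagonalEquivProd.tsum_eq F]
    have hs' : Summable (fun x => F (Finset.HasAntidiagonal.sigmaAntidiagonalEquivProd x)) :=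
      Finset.HasAntidiagonal.sigmaAntidiagonalEquivProd.summable_iff.mpr hs
    rw [Summable.tsum_sigma' (fun n => (hasSum_fintype _).summable) hs', ev]
    refine tsum_congr fun n => ?_
    rw [tsum_fintype, coeff_mul, Finset.mul_sum, Finset.univ_eq_attach]
    rw [← Finset.sum_attach (Finset.HasAntidiagonal.antidiagonal n)]
    refine Finset.sum_congr rfl fun p hp => ?_
    have := Finset.HasAntidiagonal.mem_antidiagonal.mp p.2
    simp [hF, Finset.HasAntidiagonal.sigmaAntidiagonalEquivProd, this, mul_assoc]
  have h2 : ∑' x, F x = ∑' j, z ^ j * ev U z * coeff j V := by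
    have hs2 : Summable (fun x => F (Equiv.prodComm ℕ ℕ x)) := (Equiv.prodComm ℕ ℕ).summable_iff.mpr hs
    rw [← (Equiv.prodComm ℕ ℕ).tsum_eq F, Summable.tsum_prod' hs2 (fun j => hs2.prod_factor j)]
    refine tsum_congr fun j => ?_
    rw [ev, ← Summable.tsum_mul_left _ (hU.summable hz),
      ← Summable.tsum_mul_right _ ((hU.summable hz).mul_left _)]
    refine tsum_congr fun i => ?_
    simp only [hF, Equiv.prodComm_apply, Prod.fst_swap, Prod.snd_swap]
    rw [add_comm, pow_add]; simp only [mul_assoc]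
  rw [← h1, h2]

lemma ev_mul_ne {U V : PowerSeries ℍ[ℝ]} (hU : AS U) (hV : AS V) {z : ℍ[ℝ]} (hz : ‖z‖ < 1)
    (hw : ev U z ≠ 0) : ev (U * V) z = ev U z * ev V ((ev U z)⁻¹ * z * ev U z) := by
  rw [ev_mul hU hV hz]
  set w := ev U z with hwdef
  have hn : ‖w⁻¹ * z * w‖ < 1 := by
    rw [norm_mul, norm_mul, norm_inv]
    have : ‖w‖ ≠ 0 := norm_ne_zero_iff.mpr hw
    field_simp; exact hz
  rw [ev, ← Summable.tsum_mul_left _ (hV.summable hn)]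
  refine tsum_congr fun j => ?_
  have : (w⁻¹ * z * w) ^ j = w⁻¹ * z ^ j * w := by
    simpa using (Units.conj_pow' (Units.mk0 w hw) z j)
  rw [this]
  simp only [← mul_assoc]
  rw [mul_inv_cancel₀ hw, one_mul]

lemma ev_mul_comm {U V : PowerSeries ℍ[ℝ]} (hU : AS U) (hV : AS V) {z : ℍ[ℝ]} (hz : ‖z‖ < 1)
    (hw : Commute (ev U z) z) : ev (U * V) z = ev U z * ev V z := by
  rw [ev_mul hU hV hz, ev, ev, ← Summable.tsum_mul_left _ (hV.summable hz)]
  refine tsum_congr fun j => ?_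
  rw [← mul_assoc]; congr 1; exact ((hw.pow_right j).eq).symm

lemma ev_mul_zero {U V : PowerSeries ℍ[ℝ]} (hU : AS U) (hV : AS V) {z : ℍ[ℝ]} (hz : ‖z‖ < 1)
    (hw : ev U z = 0) : ev (U * V) z = 0 := by
  rw [ev_mul hU hV hz, hw]; simp

lemma int_exp (m : ℤ) : ∫ θ in (0:ℝ)..(2 * Real.pi), Complex.exp ((m * θ : ℂ) * Complex.I) =
    if m = 0 then 2 * Real.pi else 0 := by
  split_ifs with h
  · simp [h]
  · have hc : (m * Complex.I : ℂ) ≠ 0 := by simp [h]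
    have := integral_exp_mul_complex (a := 0) (b := 2 * Real.pi) hc
    have e : ∀ θ : ℝ, Complex.exp ((m * θ : ℂ) * Complex.I) = Complex.exp (m * Complex.I * θ) := by
      intro θ; congr 1; ring
    simp_rw [e]
    rw [this]
    have : Complex.exp (m * Complex.I * ((2 * Real.pi : ℝ) : ℂ)) = 1 := by
      rw [Complex.exp_eq_one_iff]; exact ⟨m, by push_cast; ring⟩
    rw [this]; simp

lemma caratheodory (c : ℕ → ℂ) (hs : ∀ r : ℝ, 0 ≤ r → r < 1 → Summable fun n => r ^ n * ‖c n‖)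
    (c0 : c 0 = 1) (hpos : ∀ ζ : ℂ, ‖ζ‖ < 1 → 0 ≤ (∑' n, ζ ^ n * c n).re) (n : ℕ) (hn : n ≠ 0) :
    ‖c n‖ ≤ 2 := by
  have key : ∀ r : ℝ, 0 < r → r < 1 → r ^ n * ‖c n‖ ≤ 2 := by
    intro r h0 h1
    set γ : ℝ → ℂ := fun θ => r * Complex.exp (θ * Complex.I) with hγ
    have hγn : ∀ θ, ‖γ θ‖ = r := by
      intro θ; simp [hγ, Complex.norm_exp_ofReal_mul_I, abs_of_pos h0]
    set C : ℝ → ℂ := fun θ => ∑' k, γ θ ^ k * c k with hC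
    have hbound : ∀ k θ, ‖γ θ ^ k * c k‖ ≤ r ^ k * ‖c k‖ := by
      intro k θ; rw [norm_mul, norm_pow, hγn]
    have hCcont : Continuous C := by
      refine continuous_tsum (fun k => ?_) (hs r h0.le h1) hbound
      fun_prop
    have hsum : ∀ θ, Summable fun k => γ θ ^ k * c k := fun θ =>
      Summable.of_norm_bounded (hs r h0.le h1) (fun k => hbound k θ)
    have hJ : ∀ m : ℤ, HasSum (fun k : ℕ => if m + k = 0 then 2 * Real.pi * (r ^ k * c k) else 0)
        (∫ θ in (0:ℝ)..(2 * Real.pi), Complex.exp ((m * θ : ℂ) * Complex.I) * C θ) := by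
      intro m
      have h := intervalIntegral.hasSum_integral_of_dominated_convergence (μ := MeasureTheory.volume)
        (a := 0) (b := 2 * Real.pi)
        (F := fun (k : ℕ) (θ : ℝ) => Complex.exp ((m * θ : ℂ) * Complex.I) * (γ θ ^ k * c k))
        (f := fun θ : ℝ => Complex.exp ((m * θ : ℂ) * Complex.I) * C θ)
        (fun k _ => r ^ k * ‖c k‖)
        (fun k => by
          apply Continuous.aestronglyMeasurable; fun_prop)
        (fun k => by
          refine Filter.Eventually.of_forall fun θ _ => ?_
          have : ‖Complex.exp ((m * θ : ℂ) * Complex.I)‖ = 1 := by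
            simpa using Complex.norm_exp_ofReal_mul_I (m * θ)
          rw [norm_mul, this, one_mul]; exact hbound k θ)
        (Filter.Eventually.of_forall fun θ _ => hs r h0.le h1)
        (by simp)
        (Filter.Eventually.of_forall fun θ _ => (hsum θ).hasSum.mul_left _)
      convert! h using 1
      funext k
      have : ∀ θ : ℝ, Complex.exp ((m * θ : ℂ) * Complex.I) * (γ θ ^ k * c k) =
          Complex.exp ((((m + k : ℤ) : ℂ) * θ : ℂ) * Complex.I) * (r ^ k * c k) := by
        intro θ
        simp only [hγ, mul_pow, ← Complex.exp_nat_mul]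
        have : Complex.exp ((((m + k : ℤ) : ℂ) * θ : ℂ) * Complex.I) =
          Complex.exp ((m * θ : ℂ) * Complex.I) * Complex.exp (k * (θ * Complex.I)) := by
          rw [← Complex.exp_add]; congr 1; push_cast; ring
        rw [this]; ring
      simp_rw [this]
      rw [intervalIntegral.integral_mul_const, int_exp]
      split_ifs <;> simp
    have J0 : ∫ θ in (0:ℝ)..(2 * Real.pi), C θ = 2 * Real.pi := by
      have h := hJ 0
      have h2 := hasSum_single (f := fun k : ℕ => if (0:ℤ) + k = 0 then 2 * Real.pi * (r ^ k * c k) else 0)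
        0 (fun k hk => by simp [hk])
      have := h.unique h2
      simpa [c0] using this
    have Jm : ∫ θ in (0:ℝ)..(2 * Real.pi), Complex.exp ((((-n : ℤ) : ℂ) * θ : ℂ) * Complex.I) * C θ
        = 2 * Real.pi * (r ^ n * c n) := by
      have h2 := hasSum_single (f := fun k : ℕ => if (-n : ℤ) + k = 0 then 2 * Real.pi * (r ^ k * c k) else 0)
        n (fun k hk => by rw [if_neg]; omega)
      have := (hJ (-n)).unique h2
      rw [this]; simp
    have Jp : ∫ θ in (0:ℝ)..(2 * Real.pi), Complex.exp ((((n : ℤ) : ℂ) * θ : ℂ) * Complex.I) * C θ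
        = 0 := by
      refine (hJ n).unique ?_
      convert hasSum_zero using 1
      funext k
      rw [if_neg]; omega
    have hIntg : ∫ θ in (0:ℝ)..(2 * Real.pi), Complex.exp ((((-n : ℤ) : ℂ) * θ : ℂ) * Complex.I) *
        ((2 * (C θ).re : ℝ) : ℂ) = 2 * Real.pi * (r ^ n * c n) := by
      have e : ∀ θ : ℝ, Complex.exp ((((-n : ℤ) : ℂ) * θ : ℂ) * Complex.I) * ((2 * (C θ).re : ℝ) : ℂ)
          = Complex.exp ((((-n : ℤ) : ℂ) * θ : ℂ) * Complex.I) * C θ +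
            (starRingEnd ℂ) (Complex.exp ((((n : ℤ) : ℂ) * θ : ℂ) * Complex.I) * C θ) := by
        intro θ
        rw [map_mul, ← Complex.exp_conj, ← Complex.add_conj, mul_add]
        simp
      simp_rw [e]
      rw [intervalIntegral.integral_add, Jm]
      · rw [intervalIntegral.intervalIntegral_conj, Jp]; simp
      · apply Continuous.intervalIntegrable; fun_prop
      · apply Continuous.intervalIntegrable
        exact Complex.continuous_conj.comp (by fun_prop)
    have hre : ∫ θ in (0:ℝ)..(2 * Real.pi), 2 * (C θ).re = 4 * Real.pi := by
      rw [intervalIntegral.integral_const_mul]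
      have := intervalIntegral.intervalIntegral_re (𝕜 := ℂ) (μ := MeasureTheory.volume) (f := C) (a := 0) (b := 2 * Real.pi)
        (hCcont.intervalIntegrable _ _)
      simp only [RCLike.re_to_complex] at this
      rw [this, J0]; simp; ring
    have hle := intervalIntegral.norm_integral_le_integral_norm (μ := MeasureTheory.volume)
      (f := fun θ : ℝ => Complex.exp ((((-n : ℤ) : ℂ) * θ : ℂ) * Complex.I) * ((2 * (C θ).re : ℝ) : ℂ))
      (a := 0) (b := 2 * Real.pi) (by positivity)
    rw [hIntg] at hle
    have e2 : ∀ θ : ℝ, ‖Complex.exp ((((-n : ℤ) : ℂ) * θ : ℂ) * Complex.I) * ((2 * (C θ).re : ℝ) : ℂ)‖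
        = 2 * (C θ).re := by
      intro θ
      have h1 : ‖Complex.exp ((((-n : ℤ) : ℂ) * θ : ℂ) * Complex.I)‖ = 1 := by
        simpa using Complex.norm_exp_ofReal_mul_I ((-n : ℤ) * θ)
      rw [norm_mul, h1, one_mul, Complex.norm_real, Real.norm_of_nonneg]
      have := hpos (γ θ) (by rw [hγn]; assumption)
      positivity
    simp_rw [e2] at hle
    rw [hre] at hle
    simp only [norm_mul, norm_pow, Complex.norm_real, Real.norm_eq_abs, abs_of_pos h0,
      abs_of_pos Real.pi_pos, Complex.norm_ofNat] at hle
    nlinarith [Real.pi_pos]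
  have ht : Filter.Tendsto (fun r : ℝ => r ^ n * ‖c n‖) (nhdsWithin 1 (Set.Iio 1)) (nhds (1 ^ n * ‖c n‖)) := by
    apply Filter.Tendsto.mono_left _ nhdsWithin_le_nhds
    exact Continuous.tendsto (by fun_prop) 1
  rw [one_pow, one_mul] at ht
  refine le_of_tendsto ht ?_
  have : Set.Ioo (0:ℝ) 1 ∈ nhdsWithin (1:ℝ) (Set.Iio 1) := Ioo_mem_nhdsLT (by norm_num)
  filter_upwards [this] with r hr using key r hr.1 hr.2

lemma inv_summable (s : PowerSeries ℝ)
    (hs : ∀ r : ℝ, 0 ≤ r → r < 1 → Summable fun n => r ^ n * |coeff n s|)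
    (h0 : constantCoeff s ≠ 0)
    (hne : ∀ ζ : ℂ, ‖ζ‖ < 1 → ∑' n, ζ ^ n * ((coeff n s : ℝ) : ℂ) ≠ 0)
    (r : ℝ) (hr0 : 0 ≤ r) (hr1 : r < 1) : Summable fun n => r ^ n * |coeff n s⁻¹| := by
  set S : ℂ → ℂ := fun ζ => ∑' n, ζ ^ n * ((coeff n s : ℝ) : ℂ) with hS
  have hsn : ∀ ζ : ℂ, ‖ζ‖ < 1 → Summable fun n => ‖ζ ^ n * ((coeff n s : ℝ) : ℂ)‖ := by
    intro ζ hζ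
    simpa using hs ‖ζ‖ (norm_nonneg _) hζ
  have hSd : DifferentiableOn ℂ S (Metric.ball 0 1) := by
    intro ζ hζ
    obtain ⟨ρ, hρ, hρ1⟩ := exists_between (mem_ball_zero_iff.mp hζ)
    have hd : DifferentiableOn ℂ S (Metric.ball 0 ρ) := by
      refine Complex.differentiableOn_tsum_of_summable_norm (hs ρ ((norm_nonneg _).trans hρ.le) hρ1)
        (fun n => by fun_prop) Metric.isOpen_ball ?_
      intro n w hw
      have := mem_ball_zero_iff.mp hw
      rw [norm_mul, norm_pow, Complex.norm_real, Real.norm_eq_abs]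
      gcongr
    exact (hd.differentiableAt (Metric.isOpen_ball.mem_nhds (mem_ball_zero_iff.mpr hρ))).differentiableWithinAt
  have hDd : DifferentiableOn ℂ (fun ζ => (S ζ)⁻¹) (Metric.ball 0 1) :=
    hSd.inv fun ζ hζ => hne ζ (mem_ball_zero_iff.mp hζ)
  set d : ℕ → ℂ := fun n => (n.factorial : ℂ)⁻¹ * iteratedDeriv n (fun ζ => (S ζ)⁻¹) 0 with hd
  have hdsum : ∀ ζ : ℂ, ‖ζ‖ < 1 → HasSum (fun n => ζ ^ n * d n) (S ζ)⁻¹ := by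
    intro ζ hζ
    have := Complex.hasSum_taylorSeries_on_ball hDd (mem_ball_zero_iff.mpr hζ)
    convert! this using 1
    funext n
    simp [hd]; ring
  set P : PowerSeries ℂ := PowerSeries.mk d * PowerSeries.map (algebraMap ℝ ℂ) s with hP
  have hPsum : ∀ ζ : ℂ, ‖ζ‖ < 1 → HasSum (fun n => ζ ^ n * coeff n P) 1 := by
    intro ζ hζ
    have hn1 := (hdsum ζ hζ).summable.norm
    have h2 := tsum_mul_tsum_eq_tsum_sum_antidiagonal_of_summable_norm hn1 (hsn ζ hζ)
    have h3 := (summable_norm_sum_mul_antidiagonal_of_summable_norm hn1 (hsn ζ hζ)).of_norm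
    rw [(hdsum ζ hζ).tsum_eq, inv_mul_cancel₀ (hne ζ hζ)] at h2
    rw [h2]
    convert! h3.hasSum using 1
    funext n
    rw [hP, coeff_mul, Finset.mul_sum]
    refine Finset.sum_congr rfl fun p hp => ?_
    rw [← Finset.HasAntidiagonal.mem_antidiagonal.mp hp, pow_add]
    simp; ring
  have hP1 : P = 1 := by
    have hp1 : HasFPowerSeriesAt (fun _ : ℂ => (1:ℂ))
        (FormalMultilinearSeries.ofScalars ℂ (fun n => coeff n P)) 0 := by
      rw [hasFPowerSeriesAt_iff]
      filter_upwards [Metric.ball_mem_nhds (0:ℂ) one_pos] with ζ hζ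
      simpa using hPsum ζ (mem_ball_zero_iff.mp hζ)
    have hp2 : HasFPowerSeriesAt (fun _ : ℂ => (1:ℂ))
        (FormalMultilinearSeries.ofScalars ℂ (fun n => coeff n (1 : PowerSeries ℂ))) 0 := by
      rw [hasFPowerSeriesAt_iff]
      filter_upwards with ζ
      have := hasSum_single (f := fun n => ζ ^ n * coeff n (1 : PowerSeries ℂ)) 0
        (fun n hn => by simp [coeff_one, hn])
      simpa using this
    have := hp1.eq_formalMultilinearSeries hp2
    ext n
    have h := congrArg (fun q => q.coeff n) this
    simpa using h
  have hinv : PowerSeries.mk d = PowerSeries.map (algebraMap ℝ ℂ) s⁻¹ := by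
    have h1 : PowerSeries.map (algebraMap ℝ ℂ) s * PowerSeries.map (algebraMap ℝ ℂ) s⁻¹ = 1 := by
      rw [← map_mul, PowerSeries.mul_inv_cancel _ h0, map_one]
    calc PowerSeries.mk d = P * PowerSeries.map (algebraMap ℝ ℂ) s⁻¹ := by
          rw [hP, mul_assoc, h1, mul_one]
      _ = _ := by rw [hP1, one_mul]
  have hdn : ∀ n, d n = ((coeff n s⁻¹ : ℝ) : ℂ) := by
    intro n
    have := congrArg (coeff n) hinv
    simpa using this
  have := (hdsum r (by simpa [abs_of_nonneg hr0] using hr1)).summable.norm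
  simpa [hdn, abs_of_nonneg hr0] using this

/-- Embedding of the complex numbers as the slice through `I`. -/
def slc (I : ℍ[ℝ]) (ζ : ℂ) : ℍ[ℝ] := (ζ.re : ℍ[ℝ]) + ζ.im • I

structure ImUnit (I : ℍ[ℝ]) : Prop where
  re0 : I.re = 0
  nsq : I.imI ^ 2 + I.imJ ^ 2 + I.imK ^ 2 = 1

lemma ImUnit.mul_self {I : ℍ[ℝ]} (hI : ImUnit I) : I * I = -1 := by
  have h0 := hI.re0
  have h1 := hI.nsq
  ext <;> simp [h0]
  · linarith
  all_goals ring

lemma slc_mul {I : ℍ[ℝ]} (hI : ImUnit I) (ζ η : ℂ) : slc I (ζ * η) = slc I ζ * slc I η := by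
  have h0 := hI.re0
  have h1 := hI.nsq
  ext <;> simp [slc, h0]
  · linear_combination (ζ.im * η.im) * h1
  all_goals ring

lemma slc_one (I : ℍ[ℝ]) : slc I 1 = 1 := by ext <;> simp [slc]

lemma slc_pow {I : ℍ[ℝ]} (hI : ImUnit I) (ζ : ℂ) (n : ℕ) : slc I (ζ ^ n) = slc I ζ ^ n := by
  induction n with
  | zero => simp [slc_one]
  | succ n ih => rw [pow_succ, pow_succ, slc_mul hI, ih]

lemma norm_slc {I : ℍ[ℝ]} (hI : ImUnit I) (ζ : ℂ) : ‖slc I ζ‖ = ‖ζ‖ := by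
  have h0 := hI.re0
  have h1 := hI.nsq
  have h : ‖slc I ζ‖ ^ 2 = ‖ζ‖ ^ 2 := by
    rw [Complex.sq_norm, sq, ← Quaternion.normSq_eq_norm_mul_self, Quaternion.normSq_def',
      Complex.normSq_apply]
    simp [slc, h0]
    linear_combination (ζ.im ^ 2) * h1
  exact (pow_left_inj₀ (norm_nonneg _) (norm_nonneg _) two_ne_zero).mp h

/-- The slice embedding as a continuous linear map. -/
def slcL (I : ℍ[ℝ]) : ℂ →L[ℝ] ℍ[ℝ] :=
  LinearMap.toContinuousLinearMap
    { toFun := slc I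
      map_add' := fun x y => by ext <;> simp [slc] <;> ring
      map_smul' := fun x y => by ext <;> simp [slc] <;> ring }

lemma slcL_apply (I : ℍ[ℝ]) (ζ : ℂ) : slcL I ζ = slc I ζ := rfl

def qmap (s : PowerSeries ℝ) : PowerSeries ℍ[ℝ] := PowerSeries.map (algebraMap ℝ ℍ[ℝ]) s

lemma coeff_qmap (s : PowerSeries ℝ) (n : ℕ) : coeff n (qmap s) = ((coeff n s : ℝ) : ℍ[ℝ]) := by
  simp [qmap, Quaternion.algebraMap_def]

lemma qmap_comm (s : PowerSeries ℝ) (U : PowerSeries ℍ[ℝ]) : qmap s * U = U * qmap s := by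
  ext1 n
  rw [coeff_mul, coeff_mul, ← Finset.Nat.sum_antidiagonal_swap]
  refine Finset.sum_congr rfl fun p _ => ?_
  simp only [coeff_qmap, Prod.fst_swap, Prod.snd_swap]
  exact (Quaternion.coe_commutes _ _)

lemma ev_qmap {s : PowerSeries ℝ} (hs : AS (qmap s)) {I : ℍ[ℝ]} (hI : ImUnit I) {ζ : ℂ}
    (hζ : ‖ζ‖ < 1) : ev (qmap s) (slc I ζ) = slc I (∑' n, ζ ^ n * ((coeff n s : ℝ) : ℂ)) := by
  have hsum : Summable fun n => ζ ^ n * ((coeff n s : ℝ) : ℂ) := by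
    apply Summable.of_norm
    have := hs ‖ζ‖ (norm_nonneg _) hζ
    simpa [coeff_qmap] using this
  rw [← slcL_apply I (∑' n, ζ ^ n * ((coeff n s : ℝ) : ℂ)), ContinuousLinearMap.map_tsum _ hsum, ev]
  refine tsum_congr fun n => ?_
  rw [slcL_apply, slc_mul hI, slc_pow hI, coeff_qmap]
  congr 1
  ext <;> simp [slc]

def cstar (U : PowerSeries ℍ[ℝ]) : PowerSeries ℍ[ℝ] := PowerSeries.mk fun n => star (coeff n U)

lemma coeff_cstar (U : PowerSeries ℍ[ℝ]) (n : ℕ) : coeff n (cstar U) = star (coeff n U) := by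
  simp [cstar]

lemma AS.cstar {U : PowerSeries ℍ[ℝ]} (hU : AS U) : AS (cstar U) := by
  intro r h0 h1
  simpa [coeff_cstar] using hU r h0 h1

def symq (U : PowerSeries ℍ[ℝ]) : PowerSeries ℝ := PowerSeries.mk fun n => (coeff n (cstar U * U)).re

lemma cstar_mul (U : PowerSeries ℍ[ℝ]) : cstar U * U = qmap (symq U) := by
  ext1 n
  rw [coeff_qmap, symq, coeff_mk]
  apply Quaternion.star_eq_self.mp
  rw [coeff_mul, star_sum, ← Finset.Nat.sum_antidiagonal_swap]
  refine Finset.sum_congr rfl fun p _ => ?_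
  simp [coeff_cstar]

lemma re_sum' {ι : Type*} (s : Finset ι) (f : ι → ℍ[ℝ]) : (∑ i ∈ s, f i).re = ∑ i ∈ s, (f i).re := by
  classical
  induction s using Finset.induction_on with
  | empty => simp
  | insert a s ha ih => rw [Finset.sum_insert ha, Finset.sum_insert ha, Quaternion.re_add, ih]

lemma mul_cstar (U : PowerSeries ℍ[ℝ]) : U * cstar U = qmap (symq U) := by
  ext1 n
  rw [coeff_qmap, symq, coeff_mk]
  have h1 : coeff n (U * cstar U) = ((coeff n (U * cstar U)).re : ℍ[ℝ]) := by
    apply Quaternion.star_eq_self.mp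
    rw [coeff_mul, star_sum, ← Finset.Nat.sum_antidiagonal_swap]
    refine Finset.sum_congr rfl fun p _ => ?_
    simp [coeff_cstar]
  rw [h1]
  congr 1
  rw [coeff_mul, coeff_mul, re_sum', re_sum', ← Finset.Nat.sum_antidiagonal_swap]
  refine Finset.sum_congr rfl fun p _ => ?_
  simp [coeff_cstar]; ring

lemma ev_slc {U : PowerSeries ℍ[ℝ]} (hU : AS U) {I : ℍ[ℝ]} (hI : ImUnit I) {ζ : ℂ}
    (hζ : ‖ζ‖ < 1) : ev U (slc I ζ) =
      ∑' n, (ζ ^ n).re • coeff n U + I * ∑' n, (ζ ^ n).im • coeff n U := by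
  have h1 : Summable fun n => (ζ ^ n).re • coeff n U := by
    refine Summable.of_norm_bounded (hU ‖ζ‖ (norm_nonneg _) hζ) fun n => ?_
    rw [norm_smul, ← norm_pow]; gcongr; exact Complex.abs_re_le_norm _
  have h2 : Summable fun n => (ζ ^ n).im • coeff n U := by
    refine Summable.of_norm_bounded (hU ‖ζ‖ (norm_nonneg _) hζ) fun n => ?_
    rw [norm_smul, ← norm_pow]; gcongr; exact Complex.abs_im_le_norm _
  rw [← Summable.tsum_mul_left _ h2, ← Summable.tsum_add h1 (h2.mul_left _), ev]
  refine tsum_congr fun n => ?_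
  rw [← slc_pow hI, slc, add_mul, Quaternion.coe_mul_eq_smul, smul_mul_assoc, mul_smul_comm]

lemma cstar_ne {U : PowerSeries ℍ[ℝ]} (hU : AS U) (hne : ∀ q : ℍ[ℝ], ‖q‖ < 1 → ev U q ≠ 0)
    {I : ℍ[ℝ]} (hI : ImUnit I) {ζ : ℂ} (hζ : ‖ζ‖ < 1) : ev (cstar U) (slc I ζ) ≠ 0 := by
  intro hw
  have hz : ‖slc I ζ‖ < 1 := by rwa [norm_slc hI]
  have hζ' : ‖(starRingEnd ℂ) ζ‖ < 1 := by rwa [RCLike.norm_conj]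
  have hz' : ‖slc I ((starRingEnd ℂ) ζ)‖ < 1 := by rwa [norm_slc hI]
  have hAS : AS (qmap (symq U)) := by rw [← cstar_mul]; exact hU.cstar.mul hU
  have hS : ∑' n, ζ ^ n * ((coeff n (symq U) : ℝ) : ℂ) = 0 := by
    have h := ev_mul_zero hU.cstar hU hz hw
    rw [cstar_mul, ev_qmap hAS hI hζ] at h
    rw [← norm_eq_zero, ← norm_slc hI, h, norm_zero]
  have hS' : ∑' n, ((starRingEnd ℂ) ζ) ^ n * ((coeff n (symq U) : ℝ) : ℂ) = 0 := by
    have := congrArg (starRingEnd ℂ) hS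
    rw [Complex.conj_tsum] at this
    simpa using this
  have hw' : ev (cstar U) (slc I ((starRingEnd ℂ) ζ)) = 0 := by
    by_contra hc
    have h := ev_mul_ne hU.cstar hU hz' hc
    rw [cstar_mul, ev_qmap hAS hI hζ', hS'] at h
    have h0 : slc I 0 = 0 := by ext <;> simp [slc]
    rw [h0] at h
    refine mul_ne_zero hc (hne _ ?_) h.symm
    rw [norm_mul, norm_mul, norm_inv]
    have : ‖ev (cstar U) (slc I ((starRingEnd ℂ) ζ))‖ ≠ 0 := norm_ne_zero_iff.mpr hc
    field_simp; exact hz'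
  rw [ev_slc hU.cstar hI hζ] at hw
  rw [ev_slc hU.cstar hI hζ'] at hw'
  simp only [← map_pow, Complex.conj_re, Complex.conj_im, neg_smul, tsum_neg, mul_neg,
    coeff_cstar] at hw hw'
  set A := ∑' n, (ζ ^ n).re • star (coeff n U) with hA
  set B := ∑' n, (ζ ^ n).im • star (coeff n U) with hB
  have hA0 : A = 0 := by
    have : (2:ℝ) • A = 0 := by
      rw [two_smul]
      calc A + A = (A + I * B) + (A + -(I * B)) := by abel
        _ = 0 := by rw [hw, hw', add_zero]
    simpa using this
  have hI0 : I ≠ 0 := by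
    intro h; have := hI.mul_self; simp [h] at this
  have hB0 : B = 0 := by
    rw [hA0, zero_add] at hw
    exact (mul_eq_zero.mp hw).resolve_left hI0
  apply hne _ hz
  rw [ev_slc hU hI hζ]
  have e1 : ∑' n, (ζ ^ n).re • coeff n U = star A := by
    rw [hA, tsum_star]; exact tsum_congr fun n => by simp
  have e2 : ∑' n, (ζ ^ n).im • coeff n U = star B := by
    rw [hB, tsum_star]; exact tsum_congr fun n => by simp
  rw [e1, e2, hA0, hB0]; simp

def mkq (a b c d : ℝ) : ℍ[ℝ] := ⟨a, b, c, d⟩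

lemma mkq_mul_re (b c d : ℝ) (h : ℍ[ℝ]) :
    (mkq 0 b c d * h).re = - (b * h.imI + c * h.imJ + d * h.imK) := by
  rw [Quaternion.re_mul]; simp only [mkq]; ring

lemma exists_unit (h : ℍ[ℝ]) : ∃ I : ℍ[ℝ], ImUnit I ∧ ‖h‖ ^ 2 = h.re ^ 2 + (I * h).re ^ 2 := by
  set m := h.imI ^ 2 + h.imJ ^ 2 + h.imK ^ 2 with hm
  have hn : ‖h‖ ^ 2 = h.re ^ 2 + m := by
    rw [sq, ← Quaternion.normSq_eq_norm_mul_self, Quaternion.normSq_def', hm]; ring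
  by_cases h0 : m = 0
  · refine ⟨mkq 0 1 0 0, ⟨rfl, by simp [mkq]⟩, ?_⟩
    have : h.imI = 0 := by nlinarith [sq_nonneg h.imI, sq_nonneg h.imJ, sq_nonneg h.imK]
    rw [hn, h0, mkq_mul_re, this]; ring
  · have hp : 0 < m := lt_of_le_of_ne (by positivity) (Ne.symm h0)
    have hs : Real.sqrt m ^ 2 = m := Real.sq_sqrt hp.le
    have hs0 : Real.sqrt m ≠ 0 := (Real.sqrt_pos.mpr hp).ne'
    refine ⟨mkq 0 (h.imI / Real.sqrt m) (h.imJ / Real.sqrt m) (h.imK / Real.sqrt m), ⟨rfl, ?_⟩, ?_⟩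
    · simp only [mkq, div_pow, hs]; rw [← add_div, ← add_div, ← hm, div_self h0]
    · rw [hn, mkq_mul_re]
      have : h.imI / Real.sqrt m * h.imI + h.imJ / Real.sqrt m * h.imJ + h.imK / Real.sqrt m * h.imK
          = m / Real.sqrt m := by rw [hm]; ring
      have h2 : m ^ 2 / m = m := by rw [sq, mul_div_assoc, div_self h0, mul_one]
      rw [this, neg_sq, div_pow, hs, h2]

def reHom : ℍ[ℝ] →+ ℝ where
  toFun q := q.re
  map_zero' := rfl
  map_add' _ _ := rfl

lemma re_tsum' {f : ℕ → ℍ[ℝ]} (h : Summable f) : (∑' n, f n).re = ∑' n, (f n).re :=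
  ((h.hasSum.map reHom Quaternion.continuous_re).tsum_eq).symm

lemma abs_re_le (q : ℍ[ℝ]) : |q.re| ≤ ‖q‖ := by
  apply abs_le_of_sq_le_sq _ (norm_nonneg _)
  rw [sq ‖q‖, ← Quaternion.normSq_eq_norm_mul_self, Quaternion.normSq_def']
  nlinarith [sq_nonneg q.imI, sq_nonneg q.imJ, sq_nonneg q.imK]

lemma coeff_bound {H : PowerSeries ℍ[ℝ]} (hH : AS H) (h0 : coeff 0 H = 1)
    (hpos : ∀ I, ImUnit I → ∀ ζ : ℂ, ‖ζ‖ < 1 → 0 < (ev H (slc I ζ)).re) (n : ℕ) (hn : n ≠ 0) :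
    ‖coeff n H‖ ≤ 2 := by
  obtain ⟨I, hI, hnorm⟩ := exists_unit (coeff n H)
  have hI1 : ‖I‖ = 1 := by
    have := norm_slc hI Complex.I
    simpa [slc] using this
  set c : ℕ → ℂ := fun k => ⟨(coeff k H).re, -(I * coeff k H).re⟩ with hc
  have hcn : ‖c n‖ = ‖coeff n H‖ := by
    refine (pow_left_inj₀ (norm_nonneg _) (norm_nonneg _) two_ne_zero).mp ?_
    rw [hnorm, Complex.sq_norm, Complex.normSq_apply]; simp only [hc]; ring
  have hle : ∀ k, ‖c k‖ ≤ 2 * ‖coeff k H‖ := by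
    intro k
    refine (Complex.norm_le_abs_re_add_abs_im _).trans ?_
    have h1 := abs_re_le (coeff k H)
    have h2 := abs_re_le (I * coeff k H)
    rw [norm_mul, hI1, one_mul] at h2
    simp only [hc, abs_neg]; linarith
  rw [← hcn]
  have hs : ∀ r : ℝ, 0 ≤ r → r < 1 → Summable fun n => r ^ n * ‖c n‖ := by
    intro r hr0 hr1
    refine Summable.of_nonneg_of_le (fun k => mul_nonneg (pow_nonneg hr0 _) (norm_nonneg _))
      (fun k => ?_) ((hH r hr0 hr1).mul_left 2)
    have := mul_le_mul_of_nonneg_left (hle k) (pow_nonneg hr0 k)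
    linarith
  refine caratheodory c hs ?_ ?_ n hn
  · apply Complex.ext <;> simp [hc, h0, hI.re0]
  · intro ζ hζ
    have hsum : Summable fun k => ζ ^ k * c k := by
      apply Summable.of_norm
      simpa using hs ‖ζ‖ (norm_nonneg _) hζ
    have hz : ‖slc I ζ‖ < 1 := by rwa [norm_slc hI]
    have hre : (ev H (slc I ζ)).re = (∑' k, ζ ^ k * c k).re := by
      rw [Complex.re_tsum hsum, ev]
      rw [re_tsum' (hH.summable hz)]
      refine tsum_congr fun k => ?_
      rw [← slc_pow hI, slc, add_mul, Quaternion.re_add, smul_mul_assoc, Quaternion.re_smul,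
        Quaternion.coe_mul_eq_smul, Quaternion.re_smul, Complex.mul_re]
      simp [hc]; ring
    rw [← hre]; exact (hpos I hI ζ hζ).le

theorem exists_quot {U V : PowerSeries ℍ[ℝ]} (hU : AS U) (hV : AS V) (hU0 : coeff 0 U = 1)
    (hV0 : coeff 0 V = 1) (hne : ∀ q : ℍ[ℝ], ‖q‖ < 1 → ev U q ≠ 0)
    (hpos : ∀ q : ℍ[ℝ], ‖q‖ < 1 → 0 < ((ev U q)⁻¹ * ev V q).re) :
    ∃ H : PowerSeries ℍ[ℝ], U * H = V ∧ coeff 0 H = 1 ∧ ∀ n, n ≠ 0 → ‖coeff n H‖ ≤ 2 := by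
  have hAS : AS (qmap (symq U)) := by rw [← cstar_mul]; exact hU.cstar.mul hU
  have hs0 : constantCoeff (symq U) = 1 := by
    rw [← coeff_zero_eq_constantCoeff_apply, symq, coeff_mk, coeff_mul]
    simp only [Finset.Nat.antidiagonal_zero, Finset.sum_singleton, coeff_cstar, hU0]
    simp
  have hconj : ∀ w z : ℍ[ℝ], w ≠ 0 → ‖z‖ < 1 → ‖w⁻¹ * z * w‖ < 1 := by
    intro w z hw hz
    rw [norm_mul, norm_mul, norm_inv]
    have : ‖w‖ ≠ 0 := norm_ne_zero_iff.mpr hw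
    field_simp; exact hz
  have hSne : ∀ ζ : ℂ, ‖ζ‖ < 1 → ∑' n, ζ ^ n * ((coeff n (symq U) : ℝ) : ℂ) ≠ 0 := by
    intro ζ hζ h
    obtain ⟨I, hI, -⟩ := exists_unit 0
    have hz : ‖slc I ζ‖ < 1 := by rwa [norm_slc hI]
    have hw := cstar_ne hU hne hI hζ
    have h1 := ev_mul_ne hU.cstar hU hz hw
    rw [cstar_mul, ev_qmap hAS hI hζ, h] at h1
    have h0 : slc I 0 = 0 := by ext <;> simp [slc]
    rw [h0] at h1
    exact mul_ne_zero hw (hne _ (hconj _ _ hw hz)) h1.symm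
  set t := (symq U)⁻¹ with ht
  have hts : t * symq U = 1 := PowerSeries.inv_mul_cancel _ (by rw [hs0]; exact one_ne_zero)
  have hT : AS (qmap t) := by
    intro r h0 h1
    have := inv_summable (symq U) (fun r h0 h1 => by simpa [coeff_qmap] using hAS r h0 h1)
      (by rw [hs0]; exact one_ne_zero) hSne r h0 h1
    simpa [coeff_qmap] using this
  have hq1 : qmap t * qmap (symq U) = 1 := by
    rw [qmap, qmap, ← map_mul, hts, map_one]
  have hUH : U * (qmap t * (cstar U * V)) = V := by
    rw [← mul_assoc, ← qmap_comm, mul_assoc, ← mul_assoc U, mul_cstar, ← mul_assoc, hq1, one_mul]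
  have hH : AS (qmap t * (cstar U * V)) := hT.mul (hU.cstar.mul hV)
  have hH0 : coeff 0 (qmap t * (cstar U * V)) = 1 := by
    have h := congrArg (coeff 0) hUH
    rw [coeff_mul] at h
    simpa only [Finset.Nat.antidiagonal_zero, Finset.sum_singleton, hU0, hV0, one_mul] using h
  refine ⟨_, hUH, hH0, coeff_bound hH hH0 ?_⟩
  intro I hI ζ hζ
  have hz : ‖slc I ζ‖ < 1 := by rwa [norm_slc hI]
  have hw := cstar_ne hU hne hI hζ
  have hcomm : Commute (ev (qmap t) (slc I ζ)) (slc I ζ) := by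
    rw [ev_qmap hT hI hζ]
    show _ * _ = _ * _
    rw [← slc_mul hI, ← slc_mul hI, mul_comm]
  have e1 : ev (qmap t * (cstar U * V)) (slc I ζ) = _ := ev_mul_comm hT (hU.cstar.mul hV) hz hcomm
  have e2 : ev (qmap t * (cstar U * U)) (slc I ζ) = _ := ev_mul_comm hT (hU.cstar.mul hU) hz hcomm
  rw [ev_mul_ne hU.cstar hV hz hw, ← mul_assoc (ev (qmap t) (slc I ζ))] at e1
  rw [ev_mul_ne hU.cstar hU hz hw, ← mul_assoc (ev (qmap t) (slc I ζ)), cstar_mul, hq1] at e2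
  have ev1 : ev 1 (slc I ζ) = 1 := by
    rw [ev, tsum_eq_single 0 (fun n hn => by simp [coeff_one, hn])]; simp
  rw [ev1] at e2
  set K := (ev (cstar U) (slc I ζ))⁻¹ * slc I ζ * ev (cstar U) (slc I ζ) with hK
  have hKn : ‖K‖ < 1 := hconj _ _ hw hz
  rw [e1, eq_inv_of_mul_eq_one_left e2.symm]
  exact hpos K hKn

lemma AS_of_reg {a : ℕ → ℍ[ℝ]} (ha : SliceRegOn a) : AS (PowerSeries.mk fun k => a (k + 1)) := by
  intro r h0 h1
  have hρ0 : 0 < (r + 1) / 2 := by linarith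
  have hρ1 : (r + 1) / 2 < 1 := by linarith
  have hrρ : r ≤ (r + 1) / 2 := by linarith
  set ρ := (r + 1) / 2
  have hn : ‖((ρ : ℝ) : ℍ[ℝ])‖ = ρ := by rw [Quaternion.norm_coe, Real.norm_of_nonneg hρ0.le]
  have h := (ha (ρ : ℍ[ℝ]) (by rw [hn]; exact hρ1)).norm
  simp only [norm_mul, norm_pow, hn] at h
  have h2 := ((summable_nat_add_iff 1).mpr h).mul_left ρ⁻¹
  refine Summable.of_nonneg_of_le (fun k => mul_nonneg (pow_nonneg h0 _) (norm_nonneg _))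
    (fun k => ?_) h2
  rw [coeff_mk, pow_succ]
  have e : ρ⁻¹ * (ρ ^ k * ρ * ‖a (k + 1)‖) = ρ ^ k * ‖a (k + 1)‖ := by field_simp
  rw [e]
  gcongr

lemma AS_deriv {U : PowerSeries ℍ[ℝ]} (hU : AS U) :
    AS (PowerSeries.mk fun k => ((k : ℝ) + 1) • coeff k U) := by
  intro r h0 h1
  have hρ0 : 0 < (r + 1) / 2 := by linarith
  have hρ1 : (r + 1) / 2 < 1 := by linarith
  have hrρ : r < (r + 1) / 2 := by linarith
  set ρ := (r + 1) / 2
  have h := hU ρ hρ0.le hρ1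
  set M := ∑' k, ρ ^ k * ‖coeff k U‖ with hM
  have hle : ∀ k, ρ ^ k * ‖coeff k U‖ ≤ M := fun k =>
    h.le_tsum k (fun j _ => mul_nonneg (pow_nonneg hρ0.le _) (norm_nonneg _))
  have hx0 : 0 ≤ r / ρ := by positivity
  have hx : ‖r / ρ‖ < 1 := by
    rw [Real.norm_of_nonneg hx0, div_lt_one hρ0]; exact hrρ
  have hg1 := summable_pow_mul_geometric_of_norm_lt_one 1 hx
  have hg0 := summable_pow_mul_geometric_of_norm_lt_one 0 hx
  refine Summable.of_nonneg_of_le (fun k => mul_nonneg (pow_nonneg h0 _) (norm_nonneg _))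
    (fun k => ?_) ((hg1.add hg0).mul_left M)
  have hk : (0:ℝ) ≤ (k : ℝ) + 1 := by positivity
  rw [coeff_mk, norm_smul, Real.norm_of_nonneg hk]
  have e : r ^ k = (r / ρ) ^ k * ρ ^ k := by
    rw [← mul_pow, div_mul_cancel₀ _ hρ0.ne']
  calc r ^ k * (((k : ℝ) + 1) * ‖coeff k U‖)
      = (((k : ℝ) + 1) * (r / ρ) ^ k) * (ρ ^ k * ‖coeff k U‖) := by rw [e]; ring
    _ ≤ (((k : ℝ) + 1) * (r / ρ) ^ k) * M := by
        gcongr; exact hle k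
    _ = _ := by ring

lemma growth {U H : PowerSeries ℍ[ℝ]} (h0 : coeff 0 U = 1)
    (hUH : U * H = PowerSeries.mk fun k => ((k : ℝ) + 1) • coeff k U)
    (hH0 : coeff 0 H = 1) (hH : ∀ n, n ≠ 0 → ‖coeff n H‖ ≤ 2) (m : ℕ) :
    ‖coeff m U‖ ≤ (m : ℝ) + 1 := by
  induction m using Nat.strong_induction_on with
  | _ m ih =>
    rcases Nat.eq_zero_or_pos m with rfl | hm
    · simp [h0]
    have h := congrArg (coeff m) hUH
    rw [coeff_mk, coeff_mul, Finset.Nat.sum_antidiagonal_eq_sum_range_succ_mk,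
      Finset.sum_range_succ, Nat.sub_self, hH0, mul_one, add_smul, one_smul] at h
    have h2 := add_right_cancel h
    have h3 : ‖(m : ℝ) • coeff m U‖ ≤ ∑ k ∈ Finset.range m, ((k : ℝ) + 1) * 2 := by
      rw [← h2]
      refine (norm_sum_le _ _).trans (Finset.sum_le_sum fun k hk => ?_)
      have hk' := Finset.mem_range.mp hk
      rw [norm_mul]
      exact mul_le_mul (ih k hk') (hH _ (by omega)) (norm_nonneg _) (by positivity)
    have h4 : ∀ m : ℕ, ∑ k ∈ Finset.range m, ((k : ℝ) + 1) * 2 = m * ((m : ℝ) + 1) := by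
      intro m
      induction m with
      | zero => simp
      | succ n ihn => rw [Finset.sum_range_succ, ihn]; push_cast; ring
    rw [h4, norm_smul, Real.norm_of_nonneg (Nat.cast_nonneg m)] at h3
    have hmp : (0:ℝ) < m := by exact_mod_cast hm
    exact le_of_mul_le_mul_left h3 hmp

lemma starlike_bound {a : ℕ → ℍ[ℝ]} (ha : SliceStarlike a) (m : ℕ) :
    ‖a (m + 1)‖ ≤ (m : ℝ) + 1 := by
  obtain ⟨hreg, ha0, ha1, hne, hpos⟩ := ha
  set U : PowerSeries ℍ[ℝ] := PowerSeries.mk fun k => a (k + 1) with hUdef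
  have hcU : ∀ k, coeff k U = a (k + 1) := fun k => by rw [hUdef, coeff_mk]
  have hU : AS U := AS_of_reg hreg
  have hV := AS_deriv hU
  set V : PowerSeries ℍ[ℝ] := PowerSeries.mk fun k => ((k : ℝ) + 1) • coeff k U with hVdef
  have hcV : ∀ k, coeff k V = ((k : ℝ) + 1) • a (k + 1) := fun k => by rw [hVdef, coeff_mk, hcU]
  have hU0 : coeff 0 U = 1 := by rw [hcU, ha1]
  have hV0 : coeff 0 V = 1 := by rw [hcV, ha1]; simp
  have hval : ∀ q : ℍ[ℝ], ‖q‖ < 1 → sliceVal a q = q * ev U q := by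
    intro q hq
    rw [sliceVal, (hreg q hq).tsum_eq_zero_add, ha0, mul_zero, zero_add, ev,
      ← Summable.tsum_mul_left _ (hU.summable hq)]
    refine tsum_congr fun k => ?_
    rw [hcU, pow_succ', mul_assoc]
  have hder : ∀ q : ℍ[ℝ], sliceDeriv a q = ev V q := by
    intro q
    rw [sliceDeriv, ev]
    exact tsum_congr fun k => by rw [hcV]
  have ev0 : ∀ W : PowerSeries ℍ[ℝ], ev W 0 = coeff 0 W := by
    intro W
    rw [ev, tsum_eq_single 0 (fun n hn => by simp [hn])]; simp
  have hneU : ∀ q : ℍ[ℝ], ‖q‖ < 1 → ev U q ≠ 0 := by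
    intro q hq h
    by_cases hq0 : q = 0
    · rw [hq0, ev0, hU0] at h; exact one_ne_zero h
    · exact hne q hq hq0 (by rw [hval q hq, h, mul_zero])
  have hposU : ∀ q : ℍ[ℝ], ‖q‖ < 1 → 0 < ((ev U q)⁻¹ * ev V q).re := by
    intro q hq
    by_cases hq0 : q = 0
    · rw [hq0, ev0, ev0, hU0, hV0]; simp
    · have h := hpos q hq hq0
      rw [hval q hq, hder, mul_inv_rev, mul_assoc (ev U q)⁻¹, inv_mul_cancel₀ hq0, mul_one] at h
      exact h
  obtain ⟨H, hUH, hH0, hH⟩ := exists_quot hU hV hU0 hV0 hneU hposU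
  have := growth hU0 hUH hH0 hH m
  rwa [hcU] at this

lemma bohr_bound (p : ℕ → ℍ[ℝ]) (hst : SliceStarlike (fun k => (k : ℝ) • p k))
    (q : ℍ[ℝ]) (hq : ‖q‖ ≤ 1 / 2) :
    ‖q‖ + ∑' k : ℕ, ‖q‖ ^ (k + 2) * ‖p (k + 2)‖ ≤ 1 := by
  have hp : ∀ k, ‖p (k + 2)‖ ≤ 1 := by
    intro k
    have h := starlike_bound hst (k + 1)
    have hk : (0:ℝ) ≤ ((k + 1 + 1 : ℕ) : ℝ) := Nat.cast_nonneg _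
    simp only [norm_smul, Real.norm_of_nonneg hk] at h
    push_cast at h
    have hk2 : (0:ℝ) < (k : ℝ) + 1 + 1 := by positivity
    exact le_of_mul_le_mul_left (by rw [mul_one]; exact h) hk2
  have hq1 : ‖q‖ < 1 := by linarith
  have hq0 := norm_nonneg q
  have hg : HasSum (fun k : ℕ => ‖q‖ ^ (k + 2)) (‖q‖ ^ 2 * (1 - ‖q‖)⁻¹) := by
    have := (hasSum_geometric_of_lt_one hq0 hq1).mul_left (‖q‖ ^ 2)
    have e : (fun k : ℕ => ‖q‖ ^ (k + 2)) = fun k : ℕ => ‖q‖ ^ 2 * ‖q‖ ^ k := by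
      funext k; ring
    rw [e]; exact this
  have hle : ∀ k, ‖q‖ ^ (k + 2) * ‖p (k + 2)‖ ≤ ‖q‖ ^ (k + 2) := fun k =>
    mul_le_of_le_one_right (pow_nonneg hq0 _) (hp k)
  have hs : Summable fun k => ‖q‖ ^ (k + 2) * ‖p (k + 2)‖ :=
    Summable.of_nonneg_of_le (fun k => by positivity) hle hg.summable
  have h := hs.tsum_le_tsum hle hg.summable
  rw [hg.tsum_eq] at h
  have h1 : ‖q‖ ^ 2 * (1 - ‖q‖)⁻¹ ≤ 1 - ‖q‖ := by
    rw [← div_eq_mul_inv, div_le_iff₀ (by linarith)]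
    nlinarith
  linarith

lemma one_sub_ne {q : ℍ[ℝ]} (hq : ‖q‖ < 1) : 1 - q ≠ 0 := by
  intro h
  rw [← sub_eq_zero.mp h, norm_one] at hq
  exact lt_irrefl _ hq

lemma choose_two_id (k : ℕ) :
    ((k : ℝ) + 1) * ((k : ℝ) + 1) = 2 * ((k + 2).choose 2 : ℝ) - ((k + 1).choose 1 : ℝ) := by
  rw [Nat.cast_choose_two, Nat.choose_one_right]
  push_cast
  ring

lemma koebe_val {q : ℍ[ℝ]} (hq : ‖q‖ < 1) :
    HasSum (fun k : ℕ => q ^ k * ((k : ℝ) • (1 : ℍ[ℝ]))) (q * (1 - q)⁻¹ ^ 2) := by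
  have h := hasSum_coe_mul_geometric_of_norm_lt_one' hq
  rw [Ring.inverse_eq_inv] at h
  have e : (fun k : ℕ => q ^ k * ((k : ℝ) • (1 : ℍ[ℝ]))) = fun k : ℕ => (k : ℍ[ℝ]) * q ^ k := by
    funext k
    rw [mul_smul_comm, mul_one, ← Quaternion.coe_mul_eq_smul, Quaternion.coe_natCast]
  rw [e]; exact h

lemma koebe_deriv {q : ℍ[ℝ]} (hq : ‖q‖ < 1) :
    HasSum (fun k : ℕ => q ^ k * (((k : ℝ) + 1) • ((((k + 1 : ℕ) : ℝ)) • (1 : ℍ[ℝ]))))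
      ((1 + q) * (1 - q)⁻¹ ^ 3) := by
  have h2 := hasSum_choose_mul_geometric_of_norm_lt_one' 2 hq
  have h1 := hasSum_choose_mul_geometric_of_norm_lt_one' 1 hq
  rw [Ring.inverse_eq_inv] at h1 h2
  have h := (h2.mul_left 2).sub h1
  have hne := one_sub_ne hq
  have e : (1 + q) * (1 - q)⁻¹ ^ 3 = 2 * (1 - q)⁻¹ ^ (2 + 1) - (1 - q)⁻¹ ^ (1 + 1) := by
    have : (1 - q)⁻¹ ^ (1 + 1) = (1 - q) * (1 - q)⁻¹ ^ 3 := by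
      rw [pow_succ' _ 2, ← mul_assoc, mul_inv_cancel₀ hne, one_mul]
    rw [this, ← sub_mul]
    congr 1
    rw [← one_add_one_eq_two]; abel
  rw [e]
  have e' : (fun k : ℕ => q ^ k * (((k : ℝ) + 1) • ((((k + 1 : ℕ) : ℝ)) • (1 : ℍ[ℝ])))) =
      fun k : ℕ => 2 * (((k + 2).choose 2 : ℕ) * q ^ k) - ((k + 1).choose 1 : ℕ) * q ^ k := by
    funext k
    have hk := congrArg (fun x : ℝ => (x : ℍ[ℝ])) (choose_two_id k)
    simp only [Quaternion.coe_sub, Quaternion.coe_mul, Quaternion.coe_natCast] at hk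
    rw [smul_smul, mul_smul_comm, mul_one, Nat.cast_add_one, ← Quaternion.coe_mul_eq_smul,
      Quaternion.coe_mul, hk, sub_mul, mul_assoc]
    rfl
  rw [e']; exact h

lemma koebe_starlike : SliceStarlike (fun k => (k : ℝ) • (if k = 0 then (0 : ℍ[ℝ]) else 1)) := by
  have e : (fun k : ℕ => (k : ℝ) • (if k = 0 then (0 : ℍ[ℝ]) else 1)) =
      fun k : ℕ => (k : ℝ) • (1 : ℍ[ℝ]) := by
    funext k
    by_cases hk : k = 0
    · simp [hk]
    · simp [hk]
  rw [e]
  have hv : ∀ q : ℍ[ℝ], ‖q‖ < 1 →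
      sliceVal (fun k : ℕ => (k : ℝ) • (1 : ℍ[ℝ])) q = q * (1 - q)⁻¹ ^ 2 :=
    fun q hq => (koebe_val hq).tsum_eq
  have hd : ∀ q : ℍ[ℝ], ‖q‖ < 1 →
      sliceDeriv (fun k : ℕ => (k : ℝ) • (1 : ℍ[ℝ])) q = (1 + q) * (1 - q)⁻¹ ^ 3 :=
    fun q hq => (koebe_deriv hq).tsum_eq
  refine ⟨fun q hq => (koebe_val hq).summable, by simp, by simp, ?_, ?_⟩
  · intro q hq hq0
    rw [hv q hq]
    exact mul_ne_zero hq0 (pow_ne_zero _ (inv_ne_zero (one_sub_ne hq)))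
  · intro q hq hq0
    have hne := one_sub_ne hq
    rw [hv q hq, hd q hq]
    set w := 1 - q with hw
    have hc : Commute (1 + q) w := by
      rw [hw]
      exact ((Commute.one_left _).add_left ((Commute.one_right q).sub_right (Commute.refl q)))
    have hc2 : (w⁻¹ ^ 2)⁻¹ * (1 + q) = (1 + q) * (w⁻¹ ^ 2)⁻¹ :=
      ((hc.inv_right₀.pow_right 2).inv_right₀).symm
    have e1 : (q * w⁻¹ ^ 2)⁻¹ * q * ((1 + q) * w⁻¹ ^ 3) = (1 + q) * w⁻¹ := by
      rw [mul_inv_rev, mul_assoc _ q⁻¹, inv_mul_cancel₀ hq0, mul_one, ← mul_assoc, hc2, mul_assoc,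
        pow_succ _ 2, ← mul_assoc (w⁻¹ ^ 2)⁻¹,
        inv_mul_cancel₀ (pow_ne_zero _ (inv_ne_zero hne)), one_mul]
    rw [e1]
    have hpos : 0 < Quaternion.normSq w := by
      rw [Quaternion.normSq_eq_norm_mul_self]
      have := norm_pos_iff.mpr hne
      positivity
    have hq2 : q.re ^ 2 + q.imI ^ 2 + q.imJ ^ 2 + q.imK ^ 2 < 1 := by
      rw [← Quaternion.normSq_def', Quaternion.normSq_eq_norm_mul_self]
      nlinarith [norm_nonneg q]
    have e2 : w⁻¹ = (Quaternion.normSq w)⁻¹ • star w := rfl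
    rw [e2, mul_smul_comm, Quaternion.re_smul, smul_eq_mul]
    refine mul_pos (inv_pos.mpr hpos) ?_
    rw [Quaternion.re_mul, hw]
    simp
    nlinarith

lemma bohr_sharp (r : ℝ) (h1 : 1 / 2 < r) (h2 : r < 1) :
      ∃ (p : ℕ → ℍ[ℝ]) (q : ℍ[ℝ]),
        p 0 = 0 ∧ p 1 = 1 ∧ SliceRegOn p ∧ SliceStarlike (fun k => (k : ℝ) • p k) ∧
        ‖q‖ = r ∧ 1 < ‖q‖ + ∑' k : ℕ, ‖q‖ ^ (k + 2) * ‖p (k + 2)‖ := by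
  have h0 : 0 ≤ r := by linarith
  have hn : ‖(r : ℍ[ℝ])‖ = r := by rw [Quaternion.norm_coe, Real.norm_of_nonneg h0]
  refine ⟨fun k => if k = 0 then 0 else 1, (r : ℍ[ℝ]), by simp, by simp, ?_, koebe_starlike, hn, ?_⟩
  · intro q hq
    apply Summable.of_norm
    refine Summable.of_nonneg_of_le (fun _ => norm_nonneg _) (fun k => ?_)
      (summable_geometric_of_lt_one (norm_nonneg q) hq)
    rw [norm_mul, norm_pow]
    refine mul_le_of_le_one_right (by positivity) ?_
    dsimp only
    split_ifs <;> simp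
  · rw [hn]
    have e : (fun k : ℕ => r ^ (k + 2) * ‖(if k + 2 = 0 then (0 : ℍ[ℝ]) else 1)‖) =
        fun k : ℕ => r ^ 2 * r ^ k := by
      funext k
      rw [if_neg (by omega), norm_one]; ring
    rw [e, tsum_mul_left, tsum_geometric_of_lt_one h0 h2]
    have h3 : 1 - r < r ^ 2 * (1 - r)⁻¹ := by
      rw [← div_eq_mul_inv, lt_div_iff₀ (by linarith)]
      nlinarith
    linarith

end BohrAux

theorem bohr_qderiv_starlike :
    (∀ p : ℕ → ℍ[ℝ], p 0 = 0 → p 1 = 1 → SliceRegOn p →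
      SliceStarlike (fun k => (k : ℝ) • p k) →
      ∀ q : ℍ[ℝ], ‖q‖ < 1 → ‖q‖ ≤ 1 / 2 →
        ‖q‖ + ∑' k : ℕ, ‖q‖ ^ (k + 2) * ‖p (k + 2)‖ ≤ 1) ∧
    (∀ r : ℝ, 1 / 2 < r → r < 1 →
      ∃ (p : ℕ → ℍ[ℝ]) (q : ℍ[ℝ]),
        p 0 = 0 ∧ p 1 = 1 ∧ SliceRegOn p ∧ SliceStarlike (fun k => (k : ℝ) • p k) ∧
        ‖q‖ = r ∧ 1 < ‖q‖ + ∑' k : ℕ, ‖q‖ ^ (k + 2) * ‖p (k + 2)‖) :=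
  ⟨fun p _ _ _ hst q _ hq => bohr_bound p hst q hq, bohr_sharp⟩
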